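/- (Multiple Deletion Theorem, MDT) Let 𝒜 be a free arrangement in Kˡ with exponents (1, d₂, …, d_ℓ) arranged increasingly with 1 < d₂. Let H₂,…,H_q ∈ 𝒜 (2 ≤ q ≤ ℓ), set 𝒜''_j = 𝒜^{H_j} and 𝒜' = 𝒜 ∖ {H₂,…,H_q}. Assume: (1) |𝒜| − |𝒜''_j| = d_j for j = 2,…,q; (2) X = ∩_{i=2}^q Hᵢ has codimension q−1; (3) X ⊄ ∪_{K ∈ 𝒜'} K. Then 𝒜' is free with exponents (1, d₂−1, …, d_q−1, d_{q+1}, …, d_ℓ), and moreover there is a basis of D(𝒜) of the form θ_E, α₂η₂, …, α_qη_q, θ_{q+1}, …, θ_ℓ with deg ηᵢ = dᵢ−1 and deg θ_j = d_j. -/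

import Mathlib

open MvPolynomial Module

attribute [local instance] Classical.propDecidable

namespace ArrPaper

variable {K : Type*} [Field K] {ℓ m : ℕ}

/-- The polynomial coordinate ring `S = K[x₁,…,x_ℓ]`. -/
abbrev S (K : Type*) [Field K] (ℓ : ℕ) := MvPolynomial (Fin ℓ) K

/-- A polynomial derivation of `S`, given by its values on the variables. -/
abbrev Deriv (K : Type*) [Field K] (ℓ : ℕ) := Fin ℓ → S K ℓ

/-- The linear form `∑ αᵢ xᵢ` as a polynomial. -/
noncomputable def lin (α : Fin ℓ → K) : S K ℓ := ∑ i, C (α i) * X i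

/-- The value `θ(α)` of a derivation on a linear form `α`. -/
noncomputable def applyD (θ : Deriv K ℓ) (α : Fin ℓ → K) : S K ℓ := ∑ i, C (α i) * θ i

lemma applyD_add (θ η : Deriv K ℓ) (α : Fin ℓ → K) :
    applyD (θ + η) α = applyD θ α + applyD η α := by
  simp [applyD, mul_add, Finset.sum_add_distrib]

lemma applyD_smul (f : S K ℓ) (θ : Deriv K ℓ) (α : Fin ℓ → K) :
    applyD (f • θ) α = f * applyD θ α := by
  simp only [applyD, Pi.smul_apply, smul_eq_mul, Finset.mul_sum]
  exact Finset.sum_congr rfl fun i _ => by ring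

/-- The logarithmic derivation module `D(𝒜)` of an arrangement, where the
arrangement is specified by the finite set of its defining linear forms. -/
noncomputable def logDer (A : Finset (Fin ℓ → K)) : Submodule (S K ℓ) (Deriv K ℓ) where
  carrier := {θ | ∀ α ∈ A, lin α ∣ applyD θ α}
  add_mem' := by
    intro a b ha hb α hα
    rw [applyD_add]
    exact dvd_add (ha α hα) (hb α hα)
  zero_mem' := by intro α hα; simp [applyD]
  smul_mem' := by
    intro f θ hθ β hβ
    rw [applyD_smul]
    exact (hθ β hβ).mul_left f

/-- The logarithmic derivation module `D(𝒜, m)` of a multiarrangement. -/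
noncomputable def logDerM (A : Finset (Fin ℓ → K)) (mult : (Fin ℓ → K) → ℕ) :
    Submodule (S K ℓ) (Deriv K ℓ) where
  carrier := {θ | ∀ α ∈ A, (lin α) ^ (mult α) ∣ applyD θ α}
  add_mem' := by
    intro a b ha hb α hα
    rw [applyD_add]
    exact dvd_add (ha α hα) (hb α hα)
  zero_mem' := by intro α hα; simp [applyD]
  smul_mem' := by
    intro f θ hθ β hβ
    rw [applyD_smul]
    exact (hθ β hβ).mul_left f

/-- The Euler derivation. -/
noncomputable def eulerD (K : Type*) [Field K] (ℓ : ℕ) : Deriv K ℓ := fun i => X i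

/-- A derivation is homogeneous of degree `d` if all its coefficients are. -/
def IsHomog (θ : Deriv K ℓ) (d : ℕ) : Prop := ∀ i, (θ i).IsHomogeneous d

/-- A family is a (free) basis of a submodule of the derivation module. -/
def IsBasisOf {ι : Type*} (θ : ι → Deriv K ℓ) (M : Submodule (S K ℓ) (Deriv K ℓ)) : Prop :=
  (∀ i, θ i ∈ M) ∧ LinearIndependent (S K ℓ) θ ∧ Submodule.span (S K ℓ) (Set.range θ) = M

/-- `𝒜` is free with exponents `d₁,…,d_ℓ`. -/
def IsFreeWithExp (A : Finset (Fin ℓ → K)) (d : Fin ℓ → ℕ) : Prop :=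
  ∃ θ : Fin ℓ → Deriv K ℓ, IsBasisOf θ (logDer A) ∧ ∀ i, IsHomog (θ i) (d i)

/-- `(𝒜, m)` is free with exponents `d₁,…,d_ℓ`. -/
def IsFreeWithExpM (A : Finset (Fin ℓ → K)) (mult : (Fin ℓ → K) → ℕ) (d : Fin ℓ → ℕ) : Prop :=
  ∃ θ : Fin ℓ → Deriv K ℓ, IsBasisOf θ (logDerM A mult) ∧ ∀ i, IsHomog (θ i) (d i)

/-- The hyperplane `ker α ⊆ Kˡ` attached to a linear form `α`. -/
noncomputable def hyp (α : Fin ℓ → K) : Submodule K (Fin ℓ → K) :=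
  LinearMap.ker (∑ i, α i • LinearMap.proj i : (Fin ℓ → K) →ₗ[K] K)

/-- The restriction `𝒜^H = {H ∩ L : L ∈ 𝒜'}` of an arrangement `𝒜'` to the
hyperplane `H = ker α_H`, as a finite set of subspaces. -/
noncomputable def restH (A' : Finset (Fin ℓ → K)) (αH : Fin ℓ → K) :
    Finset (Submodule K (Fin ℓ → K)) :=
  A'.image (fun β => hyp αH ⊓ hyp β)

/-- The restriction `𝒜^X = {X ∩ H : H ∈ 𝒜, X ⊄ H}` to a subspace `X`. -/
noncomputable def restArr (A : Finset (Fin ℓ → K)) (Xs : Submodule K (Fin ℓ → K)) :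
    Finset (Submodule K (Fin ℓ → K)) :=
  (A.filter (fun β => ¬ Xs ≤ hyp β)).image (fun β => Xs ⊓ hyp β)

/-- Codimension of a subspace of `Kˡ`. -/
noncomputable def codim (Xs : Submodule K (Fin ℓ → K)) : ℕ := ℓ - Module.finrank K Xs

/-- The intersection lattice `L(𝒜)`. -/
noncomputable def LSet (A : Finset (Fin ℓ → K)) : Finset (Submodule K (Fin ℓ → K)) :=
  A.powerset.image (fun b => b.inf hyp)

/-- Pullback (restriction) of polynomial functions along a linear map
`ι : Kᵐ → Kˡ`. -/
noncomputable def pullback (ι : (Fin m → K) →ₗ[K] (Fin ℓ → K)) : S K ℓ →ₐ[K] S K m :=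
  aeval (fun j => ∑ i, C (ι (Pi.single i 1) j) * X i)

/-- The (Euler) restriction of a derivation onto the subspace `im ι ≅ Kᵐ`,
computed using chosen linear forms `γ i` lifting the coordinates of `Kᵐ`. -/
noncomputable def restD (ι : (Fin m → K) →ₗ[K] (Fin ℓ → K)) (γ : Fin m → (Fin ℓ → K))
    (θ : Deriv K ℓ) : Deriv K m :=
  fun i => pullback ι (applyD θ (γ i))

/-- `γ` is a system of coordinate lifts for `ι : Kᵐ → Kˡ`. -/
def CoordLifts (ι : (Fin m → K) →ₗ[K] (Fin ℓ → K)) (γ : Fin m → (Fin ℓ → K)) : Prop :=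
  ∀ i, pullback ι (lin (γ i)) = X i

/-- `B` (a finite set of forms on `Kᵐ`) represents the restricted arrangement
`𝒜^X` via the embedding `ι : Kᵐ ≅ X ⊆ Kˡ`. -/
def Represents (B : Finset (Fin m → K)) (ι : (Fin m → K) →ₗ[K] (Fin ℓ → K))
    (A : Finset (Fin ℓ → K)) (Xs : Submodule K (Fin ℓ → K)) : Prop :=
  (∀ b ∈ B, b ≠ 0) ∧ B.image (fun b => (hyp b).map ι) = restArr A Xs ∧
    B.card = (restArr A Xs).card

/-- The restricted arrangement `𝒜^X` is free with exponents `e`. -/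
def RestFree (A : Finset (Fin ℓ → K)) (Xs : Submodule K (Fin ℓ → K)) (m : ℕ)
    (e : Fin m → ℕ) : Prop :=
  ∃ (φ : (Fin m → K) ≃ₗ[K] Xs) (B : Finset (Fin m → K)),
    Represents B (Xs.subtype ∘ₗ φ.toLinearMap) A Xs ∧ IsFreeWithExp B e

/-- The Ziegler multiplicity of a hyperplane `ker b ⊆ Kᵐ ≅ H` obtained by
restricting `𝒜` onto `H = ker α_H`. -/
noncomputable def zMult (A : Finset (Fin ℓ → K)) (αH : Fin ℓ → K)
    (ι : (Fin m → K) →ₗ[K] (Fin ℓ → K)) (b : Fin m → K) : ℕ :=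
  ((A.erase αH).filter (fun β => hyp αH ⊓ hyp β = (hyp b).map ι)).card

/-- `θ ↦ θ(α)` as an `S`-linear map. -/
noncomputable def applyDL (α : Fin ℓ → K) : Deriv K ℓ →ₗ[S K ℓ] S K ℓ where
  toFun θ := applyD θ α
  map_add' a b := applyD_add a b α
  map_smul' f θ := by simpa using applyD_smul f θ α

/-- `D_H(𝒜) = {θ ∈ D(𝒜) : θ(α_H) = 0}`. -/
noncomputable def DH (A : Finset (Fin ℓ → K)) (αH : Fin ℓ → K) :
    Submodule (S K ℓ) (Deriv K ℓ) :=
  logDer A ⊓ LinearMap.ker (applyDL αH)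


/-! ### Basic facts on linear forms -/

lemma mem_hyp {α x : Fin ℓ → K} : x ∈ hyp α ↔ α ⬝ᵥ x = 0 := by
  simp [hyp, dotProduct]

lemma eval_lin (α x : Fin ℓ → K) : eval x (lin α) = α ⬝ᵥ x := by
  simp [lin, dotProduct]

lemma lin_homog (α : Fin ℓ → K) : (lin α).IsHomogeneous 1 := by
  apply IsHomogeneous.sum
  intro i _
  simpa using (isHomogeneous_C (Fin ℓ) (α i)).mul (isHomogeneous_X K i)

lemma lin_add (α β : Fin ℓ → K) : lin (α + β) = lin α + lin β := by
  simp [lin, add_mul, Finset.sum_add_distrib]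

lemma lin_smul (c : K) (α : Fin ℓ → K) : lin (c • α) = C c * lin α := by
  simp [lin, Finset.mul_sum, mul_assoc]

lemma lin_sub (α β : Fin ℓ → K) : lin (α - β) = lin α - lin β := by
  simp [lin, sub_mul, Finset.sum_sub_distrib]

lemma applyD_sub_right (θ : Deriv K ℓ) (α β : Fin ℓ → K) :
    applyD θ (α - β) = applyD θ α - applyD θ β := by
  simp [applyD, sub_mul, Finset.sum_sub_distrib]

lemma applyD_smul_right (θ : Deriv K ℓ) (c : K) (α : Fin ℓ → K) :
    applyD θ (c • α) = C c * applyD θ α := by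
  simp [applyD, Finset.mul_sum, mul_assoc]

lemma applyD_sub (θ η : Deriv K ℓ) (α : Fin ℓ → K) :
    applyD (θ - η) α = applyD θ α - applyD η α := (applyDL α).map_sub θ η

lemma applyD_neg (θ : Deriv K ℓ) (α : Fin ℓ → K) :
    applyD (-θ) α = - applyD θ α := (applyDL α).map_neg θ

lemma applyD_sum {ι : Type*} (s : Finset ι) (θ : ι → Deriv K ℓ) (α : Fin ℓ → K) :
    applyD (∑ i ∈ s, θ i) α = ∑ i ∈ s, applyD (θ i) α := map_sum (applyDL α) θ s

lemma applyD_euler (α : Fin ℓ → K) : applyD (eulerD K ℓ) α = lin α := rfl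

lemma exists_dot_one {α : Fin ℓ → K} (h : α ≠ 0) : ∃ v, α ⬝ᵥ v = 1 := by
  obtain ⟨i, hi⟩ := Function.ne_iff.1 h
  refine ⟨Pi.single i (α i)⁻¹, ?_⟩
  simp at hi
  simp [dotProduct_single, hi]

lemma eq_smul_of_hyp_le {α β : Fin ℓ → K} {v : Fin ℓ → K} (hv : α ⬝ᵥ v = 1)
    (h : hyp α ≤ hyp β) : β = (β ⬝ᵥ v) • α := by
  have key : ∀ x, β ⬝ᵥ x = (β ⬝ᵥ v) * (α ⬝ᵥ x) := by
    intro x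
    have hx : x - (α ⬝ᵥ x) • v ∈ hyp α := by
      rw [mem_hyp, dotProduct_sub, dotProduct_smul, hv]; simp
    have := mem_hyp.1 (h hx)
    rw [dotProduct_sub, dotProduct_smul, sub_eq_zero] at this
    rw [this]; simp [mul_comm]
  funext i
  have := key (Pi.single i 1)
  simpa using this

lemma hyp_le_of_dvd {α β : Fin ℓ → K} (h : lin α ∣ lin β) : hyp α ≤ hyp β := by
  intro x hx
  obtain ⟨g, hg⟩ := h
  rw [mem_hyp] at *
  rw [← eval_lin, hg, map_mul, eval_lin, hx, zero_mul]

lemma lin_ne_zero {α : Fin ℓ → K} (h : α ≠ 0) : lin α ≠ 0 := by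
  obtain ⟨v, hv⟩ := exists_dot_one h
  intro h0
  rw [← eval_lin, h0] at hv
  simp at hv

lemma dvd_of_hyp_le {α β : Fin ℓ → K} (hα : α ≠ 0) (h : hyp α ≤ hyp β) : 
    ∃ c : K, β = c • α := by
  obtain ⟨v, hv⟩ := exists_dot_one hα
  exact ⟨_, eq_smul_of_hyp_le hv h⟩

lemma lin_irreducible {α : Fin ℓ → K} (h : α ≠ 0) : Irreducible (lin α) := by
  have : lin α = sumSMulX (Finsupp.equivFunOnFinite.symm α) := by
    simp [lin, sumSMulX, Finsupp.linearCombination_apply, Finsupp.sum_fintype, smul_eq_C_mul]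
  rw [this]
  obtain ⟨i, hi⟩ := Function.ne_iff.1 h
  simp at hi
  apply irreducible_sumSMulX
  · exact ⟨i, by simpa using hi⟩
  · intro r hr
    have := hr i
    simp at this
    rw [isUnit_iff_ne_zero]
    rintro rfl
    exact hi (by simpa using this)

lemma lin_prime {α : Fin ℓ → K} (h : α ≠ 0) : Prime (lin α) := (lin_irreducible h).prime

lemma hyp_smul {c : K} (hc : c ≠ 0) (α : Fin ℓ → K) : hyp (c • α) = hyp α := by
  ext x
  simp [mem_hyp, hc]

lemma hyp_eq_of_le {α β : Fin ℓ → K} (hα : α ≠ 0) (hβ : β ≠ 0) (h : hyp α ≤ hyp β) :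
    hyp α = hyp β := by
  obtain ⟨c, rfl⟩ := dvd_of_hyp_le hα h
  have : c ≠ 0 := by rintro rfl; simp at hβ
  rw [hyp_smul this]

lemma lin_relPrime {α β : Fin ℓ → K} (hα : α ≠ 0) (hβ : β ≠ 0) (h : hyp α ≠ hyp β) :
    IsRelPrime (lin α) (lin β) := by
  rw [(lin_irreducible hα).isRelPrime_iff_not_dvd]
  intro hd
  exact h (hyp_eq_of_le hα hβ (hyp_le_of_dvd hd))

/-- product of linear forms -/
noncomputable def Qp (A : Finset (Fin ℓ → K)) : S K ℓ := ∏ β ∈ A, lin β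

lemma Qp_ne_zero {A : Finset (Fin ℓ → K)} (hA : ∀ α ∈ A, α ≠ 0) : Qp A ≠ 0 :=
  Finset.prod_ne_zero_iff.2 fun β hβ => lin_ne_zero (hA β hβ)

/-- Reduced arrangements. -/
def Red (A : Finset (Fin ℓ → K)) : Prop := (∀ α ∈ A, α ≠ 0) ∧ Set.InjOn hyp (A : Set (Fin ℓ → K))

lemma Qp_dvd {A : Finset (Fin ℓ → K)} (hA : Red A) {f : S K ℓ} (h : ∀ β ∈ A, lin β ∣ f) :
    Qp A ∣ f := by
  apply Finset.prod_dvd_of_isRelPrime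
  · intro β hβ γ hγ hne
    exact lin_relPrime (hA.1 _ hβ) (hA.1 _ hγ) fun h => hne (hA.2 hβ hγ h)
  · exact h

/-! ### Determinants -/

/-- If `g` divides `θ_i(z)` for all `i`, then `g` divides the determinant. -/
lemma dvd_det {z : Fin ℓ → K} (hz : z ≠ 0) {g : S K ℓ} (M : Matrix (Fin ℓ) (Fin ℓ) (S K ℓ))
    (h : ∀ i, g ∣ applyD (M i) z) : g ∣ M.det := by
  choose c hc using h
  obtain ⟨v, hv⟩ := exists_dot_one hz
  -- solve by the adjugate
  have h1 : M.mulVec (fun i => C (z i)) = g • c := by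
    funext i
    simp only [Matrix.mulVec, dotProduct, Pi.smul_apply, smul_eq_mul, ← hc i, applyD]
    exact Finset.sum_congr rfl fun _ _ => mul_comm _ _
  have h2 : M.det • (fun i => (C (z i) : S K ℓ)) = g • M.adjugate.mulVec c := by
    rw [← Matrix.mulVec_smul, ← h1, Matrix.mulVec_mulVec, Matrix.adjugate_mul,
      Matrix.smul_mulVec, Matrix.one_mulVec]
  obtain ⟨i, hi⟩ := Function.ne_iff.1 hz
  have h3 := congrFun h2 i
  simp only [Pi.smul_apply, smul_eq_mul] at h3
  refine ⟨C (z i)⁻¹ * M.adjugate.mulVec c i, ?_⟩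
  simp only [Pi.zero_apply] at hi
  calc M.det = C (z i * (z i)⁻¹) * M.det := by rw [mul_inv_cancel₀ hi]; simp
    _ = (M.det * C (z i)) * C (z i)⁻¹ := by rw [C_mul]; ring
    _ = _ := by rw [h3]; ring

lemma cramer_solve {R : Type*} [CommRing R] [IsDomain R] {n : ℕ} (M : Matrix (Fin n) (Fin n) R)
    (h0 : M.det ≠ 0) (w : Fin n → R) (h : ∀ i, M.det ∣ (M.updateRow i w).det) :
    ∃ g : Fin n → R, w = ∑ i, g i • M i ∧ ∀ i, (M.updateRow i w).det = M.det * g i := by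
  choose g hg using h
  refine ⟨g, ?_, hg⟩
  have h1 := Matrix.mulVec_cramer M.transpose w
  have h2 : Matrix.cramer M.transpose w = M.det • g := by
    funext i
    rw [Matrix.cramer_transpose_apply, hg]; rfl
  rw [h2, Matrix.mulVec_smul, Matrix.det_transpose] at h1
  have h3 : M.transpose.mulVec g = w := by
    funext i
    exact mul_left_cancel₀ h0 (congrFun h1 i)
  rw [← h3]
  funext j
  simp [Matrix.mulVec, dotProduct, Matrix.transpose_apply, mul_comm]

/-- Saito's condition. -/
def Sai (A : Finset (Fin ℓ → K)) (θ : Fin ℓ → Deriv K ℓ) : Prop :=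
  (∀ i, θ i ∈ logDer A) ∧ (Matrix.of θ).det ≠ 0 ∧ (Matrix.of θ).det ∣ Qp A

lemma Qp_dvd_det {A : Finset (Fin ℓ → K)} (hA : Red A) (M : Matrix (Fin ℓ) (Fin ℓ) (S K ℓ))
    (h : ∀ i, M i ∈ logDer A) : Qp A ∣ M.det :=
  Qp_dvd hA fun β hβ => dvd_det (hA.1 β hβ) M fun i => h i β hβ

lemma Sai.exists_coeff {A : Finset (Fin ℓ → K)} (hA : Red A) {θ : Fin ℓ → Deriv K ℓ}
    (h : Sai A θ) {w : Deriv K ℓ} (hw : w ∈ logDer A) : ∃ g : Fin ℓ → S K ℓ, w = ∑ i, g i • θ i := by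
  obtain ⟨g, hg, -⟩ := cramer_solve (Matrix.of θ) h.2.1 w (fun i => by
    refine h.2.2.trans (Qp_dvd_det hA _ fun k => ?_)
    by_cases hk : k = i
    · subst hk; rw [Matrix.updateRow_self]; exact hw
    · rw [Matrix.updateRow_ne hk]; exact h.1 k)
  exact ⟨g, hg⟩

lemma Sai.isBasisOf {A : Finset (Fin ℓ → K)} (hA : Red A) {θ : Fin ℓ → Deriv K ℓ}
    (h : Sai A θ) : IsBasisOf θ (logDer A) := by
  refine ⟨h.1, Matrix.linearIndependent_rows_of_det_ne_zero h.2.1, le_antisymm ?_ ?_⟩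
  · rw [Submodule.span_le]
    rintro _ ⟨i, rfl⟩
    exact h.1 i
  · intro w hw
    obtain ⟨g, rfl⟩ := h.exists_coeff hA hw
    exact Submodule.sum_mem _ fun i _ => Submodule.smul_mem _ _ (Submodule.subset_span ⟨i, rfl⟩)

lemma sai_of_isBasisOf {A : Finset (Fin ℓ → K)} (hA : Red A) (hne : A.Nonempty)
    {θ : Fin ℓ → Deriv K ℓ} (h : IsBasisOf θ (logDer A)) : Sai A θ := by
  obtain ⟨hmem, hli, hspan⟩ := h
  have hdet : (Matrix.of θ).det ≠ 0 := by
    intro h0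
    obtain ⟨v, hv, hv0⟩ := Matrix.exists_vecMul_eq_zero_iff.2 h0
    apply hv
    funext i
    refine Fintype.linearIndependent_iff.1 hli v ?_ i
    rw [← hv0]
    funext j
    simp [Matrix.vecMul, dotProduct]
  refine ⟨hmem, hdet, ?_⟩
  obtain ⟨u, hu⟩ := Qp_dvd_det hA (Matrix.of θ) hmem
  have hQ0 := Qp_ne_zero hA.1
  -- key divisibility
  have key : ∀ β ∈ A, u ∣ (Qp (A.erase β)) ^ (ℓ - 1) := by
    intro β hβ
    obtain ⟨t, ht⟩ := Function.ne_iff.1 (hA.1 β hβ)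
    simp only [Pi.zero_apply] at ht
    have hQβ : Qp A = lin β * Qp (A.erase β) := (Finset.mul_prod_erase A lin hβ).symm
    let uu : Fin ℓ → S K ℓ := fun k => if k = t then 1 else C (-(β k / β t))
    let P : Matrix (Fin ℓ) (Fin ℓ) (S K ℓ) := (1 : Matrix (Fin ℓ) (Fin ℓ) (S K ℓ)).updateCol t uu
    let D : Fin ℓ → S K ℓ := fun k => if k = t then Qp A else Qp (A.erase β)
    have hP : P.det = 1 := by
      have : P.det = Matrix.cramer (1 : Matrix (Fin ℓ) (Fin ℓ) (S K ℓ)) uu t :=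
        (Matrix.cramer_apply _ _ _).symm
      rw [this, Matrix.cramer_one]
      simp [uu]
    let N : Matrix (Fin ℓ) (Fin ℓ) (S K ℓ) := Matrix.of fun i j => D i * P i j
    have hN : N.det = Qp A * (Qp (A.erase β)) ^ (ℓ - 1) := by
      rw [Matrix.det_mul_column, hP, mul_one]
      rw [← Finset.mul_prod_erase Finset.univ D (Finset.mem_univ t)]
      congr 1
      · simp [D]
      · rw [Finset.prod_congr rfl (g := fun _ => Qp (A.erase β))]
        · simp
        · intro k hk
          simp [D, Finset.ne_of_mem_erase hk]
    have hNmem : ∀ i, N i ∈ logDer A := by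
      intro i γ hγ
      have hNi : N i = D i • P i := rfl
      rw [hNi, applyD_smul]
      by_cases hi : i = t
      · simp only [D, hi, if_true]
        exact (Finset.dvd_prod_of_mem lin hγ).mul_right _
      · simp only [D, hi, if_false]
        by_cases hγβ : γ = β
        · subst hγβ
          have : applyD (P i) γ = 0 := by
            have hPi : ∀ j, P i j = if j = t then C (-(γ i / γ t)) else if j = i then 1 else 0 := by
              intro j
              simp only [P, Matrix.updateCol_apply, uu, hi, if_false, Matrix.one_apply, eq_comm (a := i)]
            simp only [applyD, hPi]
            rw [← Finset.add_sum_erase _ _ (Finset.mem_univ t),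
              Finset.sum_eq_single_of_mem i (by simp [hi])]
            · simp only [if_true, hi, if_false, mul_one, ← C_mul, ← C_add]
              rw [show γ t * -(γ i / γ t) + γ i = 0 by field_simp; ring, C_0]
            · intro j hj hji
              simp [Finset.ne_of_mem_erase hj, hji]
          rw [this]; simp
        · exact (Finset.dvd_prod_of_mem lin (Finset.mem_erase.2 ⟨hγβ, hγ⟩)).mul_right _
    have hG : ∀ i, ∃ g : Fin ℓ → S K ℓ, ∑ j, g j • θ j = N i := by
      intro i
      have := hNmem i
      rw [← hspan] at this
      exact (Submodule.mem_span_range_iff_exists_fun _).1 this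
    choose G hG using hG
    have hNG : N = Matrix.of G * Matrix.of θ := by
      ext1 i j
      rw [← hG i]
      simp [Matrix.mul_apply]
    have hd : (Matrix.of θ).det ∣ N.det := by
      rw [hNG, Matrix.det_mul]; exact Dvd.intro_left _ rfl
    rw [hu, hN] at hd
    exact (mul_dvd_mul_iff_left hQ0).1 hd
  have hunit : IsUnit u := by
    by_contra hnu
    have hu0 : u ≠ 0 := by rintro rfl; simp at hu; exact hdet hu
    obtain ⟨p, hp, hpu⟩ := WfDvdMonoid.exists_irreducible_factor hnu hu0
    have hpp := hp.prime
    have h2 : ∀ β ∈ A, ∃ γ ∈ A.erase β, p ∣ lin γ := by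
      intro β hβ
      have := hpp.dvd_of_dvd_pow (hpu.trans (key β hβ))
      exact (hpp.dvd_finsetProd_iff _).1 this
    obtain ⟨β, hβ⟩ := hne
    obtain ⟨γ, hγ, hpγ⟩ := h2 β hβ
    have hγA := Finset.mem_of_mem_erase hγ
    obtain ⟨δ, hδ, hpδ⟩ := h2 γ hγA
    have hδA := Finset.mem_of_mem_erase hδ
    exact hpp.not_isUnit (lin_relPrime (hA.1 _ hγA) (hA.1 _ hδA)
      (fun h => Finset.ne_of_mem_erase hδ (hA.2 hδA hγA h.symm)) hpγ hpδ)
  rw [hu]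
  exact (hunit.mul_right_dvd).2 dvd_rfl

lemma euler_mem (A : Finset (Fin ℓ → K)) : eulerD K ℓ ∈ logDer A := fun _ _ => dvd_rfl

/-! ### Restriction to a hyperplane, as a retraction of the polynomial ring -/

/-- The retraction `x ↦ x - α(x) v`. -/
noncomputable def rho (α v : Fin ℓ → K) : S K ℓ →ₐ[K] S K ℓ :=
  aeval (fun i => X i - C (v i) * lin α)

lemma rho_lin (α v β : Fin ℓ → K) : rho α v (lin β) = lin (β - (β ⬝ᵥ v) • α) := by
  rw [lin_sub, lin_smul]
  have : rho α v (lin β) = ∑ i, C (β i) * (X i - C (v i) * lin α) := by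
    conv_lhs => rw [lin]
    simp [rho, algebraMap_eq]
  rw [this]
  simp only [mul_sub, Finset.sum_sub_distrib]
  congr 1
  rw [dotProduct, map_sum, Finset.sum_mul]
  exact Finset.sum_congr rfl fun i _ => by rw [C_mul]; ring

lemma rho_C (α v : Fin ℓ → K) (c : K) : rho α v (C c) = C c := by
  simp [rho, algebraMap_eq]

lemma rho_sub_dvd (α v : Fin ℓ → K) (f : S K ℓ) : lin α ∣ rho α v f - f := by
  induction f using MvPolynomial.induction_on with
  | C a => simp
  | add p q hp hq =>
    rw [map_add, add_sub_add_comm]; exact dvd_add hp hq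
  | mul_X p i hp =>
    have h1 : rho α v (X i) = X i - C (v i) * lin α := by simp [rho]
    rw [map_mul, h1]
    have : rho α v p * (X i - C (v i) * lin α) - p * X i
        = (rho α v p - p) * X i - lin α * (C (v i) * rho α v p) := by ring
    rw [this]
    exact dvd_sub (hp.mul_right _) (Dvd.intro _ rfl)

lemma dvd_of_rho_eq_zero {α v : Fin ℓ → K} {f : S K ℓ} (h : rho α v f = 0) : lin α ∣ f := by
  have := rho_sub_dvd α v f
  rw [h, zero_sub] at this
  exact (dvd_neg.1 this)

lemma rho_self {α v : Fin ℓ → K} (hv : α ⬝ᵥ v = 1) : rho α v (lin α) = 0 := by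
  rw [rho_lin, hv]; simp [lin]

lemma rho_idem {α v : Fin ℓ → K} (hv : α ⬝ᵥ v = 1) (f : S K ℓ) :
    rho α v (rho α v f) = rho α v f := by
  obtain ⟨g, hg⟩ := rho_sub_dvd α v f
  have := congrArg (rho α v) hg
  rw [map_sub, map_mul, rho_self hv, zero_mul, sub_eq_zero] at this
  exact this

/-- Apply `rho` to all coefficients. -/
noncomputable def rhoD (α v : Fin ℓ → K) (θ : Deriv K ℓ) : Deriv K ℓ := fun i => rho α v (θ i)

lemma applyD_rhoD (α v β : Fin ℓ → K) (θ : Deriv K ℓ) :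
    applyD (rhoD α v θ) β = rho α v (applyD θ β) := by
  simp [applyD, rhoD]

lemma rhoD_smul (α v : Fin ℓ → K) (f : S K ℓ) (θ : Deriv K ℓ) :
    rhoD α v (f • θ) = rho α v f • rhoD α v θ := by
  funext i; simp [rhoD]

lemma rhoD_sum {ι : Type*} (α v : Fin ℓ → K) (s : Finset ι) (θ : ι → Deriv K ℓ) :
    rhoD α v (∑ i ∈ s, θ i) = ∑ i ∈ s, rhoD α v (θ i) := by
  funext i; simp [rhoD]

/-- the restricted form -/
lemma proj_ne_zero {α v β : Fin ℓ → K} (hβ : β ≠ 0) (h : hyp β ≠ hyp α) :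
    β - (β ⬝ᵥ v) • α ≠ 0 := by
  intro h0
  rw [sub_eq_zero] at h0
  have hc : β ⬝ᵥ v ≠ 0 := by
    intro hc; rw [hc] at h0; simp at h0; exact hβ h0
  apply h
  rw [h0, hyp_smul hc]

lemma proj_smul_of_inf_eq {α v β γ : Fin ℓ → K} (hv : α ⬝ᵥ v = 1) (hβ : β ≠ 0)
    (h : hyp β ≠ hyp α) (he : hyp α ⊓ hyp β = hyp α ⊓ hyp γ) :
    ∃ c : K, γ - (γ ⬝ᵥ v) • α = c • (β - (β ⬝ᵥ v) • α) := by
  apply dvd_of_hyp_le (proj_ne_zero hβ h)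
  intro x hx
  rw [mem_hyp, sub_dotProduct, smul_dotProduct] at *
  have h1 : x - (α ⬝ᵥ x) • v ∈ hyp α ⊓ hyp β := by
    refine ⟨?_, ?_⟩
    · rw [SetLike.mem_coe, mem_hyp, dotProduct_sub, dotProduct_smul, hv]; simp
    · rw [SetLike.mem_coe, mem_hyp, dotProduct_sub, dotProduct_smul, ← hx]; simp [mul_comm]
  rw [he] at h1
  have h2 := mem_hyp.1 h1.2
  rw [dotProduct_sub, dotProduct_smul] at h2
  rw [← h2]; simp [mul_comm]

lemma inf_eq_of_proj_hyp {α v β γ : Fin ℓ → K}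
    (h : hyp (β - (β ⬝ᵥ v) • α) = hyp (γ - (γ ⬝ᵥ v) • α)) :
    hyp α ⊓ hyp β = hyp α ⊓ hyp γ := by
  ext x
  have hx : x ∈ hyp (β - (β ⬝ᵥ v) • α) ↔ x ∈ hyp (γ - (γ ⬝ᵥ v) • α) := by rw [h]
  simp only [mem_hyp, sub_dotProduct, smul_dotProduct, Submodule.mem_inf] at *
  constructor
  · rintro ⟨h1, h2⟩
    simp [h1, h2] at hx
    exact ⟨h1, hx⟩
  · rintro ⟨h1, h2⟩
    simp [h1, h2] at hx
    exact ⟨h1, hx⟩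

lemma surj {A : Finset (Fin ℓ → K)} (hA : Red A) {θ : Fin ℓ → Deriv K ℓ} (hθ : Sai A θ)
    (i0 : Fin ℓ) (hE : θ i0 = eulerD K ℓ) {α : Fin ℓ → K} (hα : α ∈ A)
    (T R : Finset (Fin ℓ → K)) (hcov : ∀ β ∈ A.erase α, β ∈ T ∨ β ∈ R)
    (hR : Set.InjOn (fun β => hyp α ⊓ hyp β) (R : Set (Fin ℓ → K))) :
    ∃ η : Deriv K ℓ, lin α • η ∈ logDer A ∧ applyD η α = Qp T := by
  have hα0 := hA.1 α hα
  have hlα := lin_ne_zero hα0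
  obtain ⟨v, hv⟩ := exists_dot_one hα0
  have hf : ∀ i, ∃ f, applyD (θ i) α = lin α * f := fun i => hθ.1 i α hα
  choose f hf using hf
  let θ' : Fin ℓ → Deriv K ℓ := fun i => θ i - f i • eulerD K ℓ
  have hθ'mem : ∀ i, θ' i ∈ logDer A := fun i =>
    Submodule.sub_mem _ (hθ.1 i) (Submodule.smul_mem _ _ (euler_mem A))
  have hθ'α : ∀ i, applyD (θ' i) α = 0 := by
    intro i
    simp only [θ']
    rw [applyD_sub, applyD_smul, hf, applyD_euler]; ring
  let vD : Deriv K ℓ := fun i => C (v i)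
  have hvD : ∀ β, applyD vD β = C (β ⬝ᵥ v) := by
    intro β; simp [applyD, vD, dotProduct]
  let N : Matrix (Fin ℓ) (Fin ℓ) (S K ℓ) := Matrix.of fun i => if i = i0 then vD else θ' i
  have hN0 : N i0 = vD := by
    show (if i0 = i0 then vD else θ' i0) = vD
    rw [if_pos rfl]
  have hN1 : ∀ i, i ≠ i0 → N i = θ' i := by
    intro i hi
    show (if i = i0 then vD else θ' i) = _
    rw [if_neg hi]
  have hdetN : (Matrix.of θ).det = lin α * N.det := by
    have h1 : (Matrix.of θ).det = (N.updateRow i0 (eulerD K ℓ)).det := by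
      apply Matrix.det_eq_of_forall_row_eq_smul_add_const (fun i => if i = i0 then 0 else f i) i0
        (if_pos rfl)
      intro i j
      by_cases hi : i = i0
      · subst hi
        simp [hE]
      · rw [Matrix.updateRow_ne hi, Matrix.updateRow_self, hN1 i hi]
        simp [hi, θ']
    have h2 : eulerD K ℓ = lin α • vD + (eulerD K ℓ - lin α • vD) := by abel
    rw [h1, h2, Matrix.det_updateRow_add, Matrix.det_updateRow_smul]
    have h3 : (N.updateRow i0 vD) = N := by rw [← hN0, Matrix.updateRow_eq_self]
    have h4 : (N.updateRow i0 (eulerD K ℓ - lin α • vD)).det = 0 := by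
      apply zero_dvd_iff.1
      apply dvd_det hα0
      intro i
      by_cases hi : i = i0
      · subst hi
        rw [Matrix.updateRow_self, applyD_sub, applyD_smul, hvD, hv, applyD_euler]
        simp
      · rw [Matrix.updateRow_ne hi, hN1 i hi, hθ'α]
    rw [h3, h4, add_zero]
  have hNdvd : N.det ∣ Qp (A.erase α) := by
    have h1 := hθ.2.2
    have hQ : Qp A = lin α * Qp (A.erase α) := (Finset.mul_prod_erase A lin hα).symm
    rw [hdetN, hQ] at h1
    exact (mul_dvd_mul_iff_left hlα).1 h1
  -- restricted forms
  let z : (Fin ℓ → K) → (Fin ℓ → K) := fun β => β - (β ⬝ᵥ v) • α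
  have hE0 : ∀ β ∈ A.erase α, β ≠ 0 := fun β hβ => hA.1 β (Finset.mem_of_mem_erase hβ)
  have hEα : ∀ β ∈ A.erase α, hyp β ≠ hyp α := fun β hβ h =>
    Finset.ne_of_mem_erase hβ (hA.2 (Finset.mem_of_mem_erase hβ) hα h)
  have hz0 : ∀ β ∈ A.erase α, z β ≠ 0 := fun β hβ => proj_ne_zero (hE0 β hβ) (hEα β hβ)
  have hρQ : ∀ B : Finset (Fin ℓ → K), rho α v (Qp B) = ∏ β ∈ B, lin (z β) := by
    intro B
    rw [Qp, map_prod]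
    exact Finset.prod_congr rfl fun β _ => rho_lin α v β
  have hρQ0 : rho α v (Qp (A.erase α)) ≠ 0 := by
    rw [hρQ]
    exact Finset.prod_ne_zero_iff.2 fun β hβ => lin_ne_zero (hz0 β hβ)
  let Nρ : Matrix (Fin ℓ) (Fin ℓ) (S K ℓ) := N.map (rho α v)
  have hNρ : ∀ i, Nρ i = rhoD α v (N i) := fun i => rfl
  have hdetNρ : Nρ.det = rho α v N.det := ((rho α v).map_det N).symm
  have hdvdρ : Nρ.det ∣ rho α v (Qp (A.erase α)) := by
    rw [hdetNρ]; exact map_dvd _ hNdvd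
  have hNρ0 : Nρ.det ≠ 0 := fun h => hρQ0 (by rw [h] at hdvdρ; exact zero_dvd_iff.1 hdvdρ)
  let w : Deriv K ℓ := rhoD α v (Qp T • eulerD K ℓ)
  have hwapp : ∀ β, applyD w β = rho α v (Qp T) * lin (z β) := by
    intro β
    rw [applyD_rhoD, applyD_smul, map_mul, applyD_euler, rho_lin]
  -- the main divisibility
  have hmain : ∀ i, rho α v (Qp (A.erase α)) ∣ (Nρ.updateRow i w).det := by
    intro i
    rw [hρQ, ← Finset.prod_fiberwise_of_maps_to (s := A.erase α)
      (t := (A.erase α).image (fun β => hyp α ⊓ hyp β)) (g := fun β => hyp α ⊓ hyp β)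
      (fun β hβ => Finset.mem_image_of_mem _ hβ)]
    apply Finset.prod_dvd_of_isRelPrime
    · intro c _ c' _ hne
      apply IsRelPrime.prod_left
      intro β hβ
      apply IsRelPrime.prod_right
      intro γ hγ
      rw [Finset.mem_filter] at hβ hγ
      apply lin_relPrime (hz0 β hβ.1) (hz0 γ hγ.1)
      intro h
      exact hne (by rw [← hβ.2, ← hγ.2]; exact inf_eq_of_proj_hyp h)
    · intro c hc
      obtain ⟨β, hβ, hβc⟩ := Finset.mem_image.1 hc
      have hprop : ∀ γ ∈ (A.erase α).filter (fun γ => hyp α ⊓ hyp γ = c),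
          ∃ b : K, z β = b • z γ := by
        intro γ hγ
        rw [Finset.mem_filter] at hγ
        exact proj_smul_of_inf_eq hv (hE0 γ hγ.1) (hEα γ hγ.1) (by rw [hγ.2, ← hβc])
      apply dvd_det (hz0 β hβ)
      have hwd : ∏ γ ∈ (A.erase α).filter (fun γ => hyp α ⊓ hyp γ = c), lin (z γ) ∣
          applyD w (z β) := by
        have hzz : z (z β) = z β := by
          simp only [z]
          rw [sub_dotProduct, smul_dotProduct, hv]
          simp
        rw [hwapp, hzz, hρQ]
        set F := (A.erase α).filter (fun γ => hyp α ⊓ hyp γ = c) with hF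
        by_cases hex : ∃ γ ∈ F, γ ∉ T
        · obtain ⟨γ, hγ, hγT⟩ := hex
          rw [← Finset.prod_erase_mul F _ hγ]
          apply mul_dvd_mul
          · apply Finset.prod_dvd_prod_of_subset
            intro δ hδ
            by_contra hδT
            have hδF := Finset.mem_of_mem_erase hδ
            have hγ' := Finset.mem_filter.1 hγ
            have hδ' := Finset.mem_filter.1 hδF
            have hγR := (hcov γ hγ'.1).resolve_left hγT
            have hδR := (hcov δ hδ'.1).resolve_left hδT
            exact Finset.ne_of_mem_erase hδ (hR hδR hγR (hδ'.2.trans hγ'.2.symm))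
          · obtain ⟨b, hb⟩ := hprop γ hγ
            rw [hb, lin_smul]
            exact Dvd.intro_left _ rfl
        · push Not at hex
          exact (Finset.prod_dvd_prod_of_subset _ _ _ hex).mul_right _
      have hNd : ∀ k, ∏ γ ∈ (A.erase α).filter (fun γ => hyp α ⊓ hyp γ = c), lin (z γ) ∣
          applyD (Nρ k) (z β) := by
        intro k
        rw [hNρ, applyD_rhoD]
        by_cases hk : k = i0
        · subst hk
          rw [hN0, hvD]
          simp only [z]
          rw [sub_dotProduct, smul_dotProduct, hv]
          simp
        · rw [hN1 k hk, ← hρQ]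
          apply map_dvd
          apply Qp_dvd
          · exact ⟨fun γ hγ => hE0 γ (Finset.mem_filter.1 hγ).1, hA.2.mono fun γ hγ =>
              Finset.mem_of_mem_erase (Finset.mem_filter.1 hγ).1⟩
          · intro γ hγ
            obtain ⟨b, hb⟩ := hprop γ hγ
            have hγA := Finset.mem_of_mem_erase (Finset.mem_filter.1 hγ).1
            rw [hb, applyD_smul_right]
            simp only [z]
            rw [applyD_sub_right, applyD_smul_right, hθ'α, mul_zero, sub_zero]
            exact (hθ'mem k γ hγA).mul_left _
      intro k
      by_cases hk : k = i
      · subst hk; rw [Matrix.updateRow_self]; exact hwd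
      · rw [Matrix.updateRow_ne hk]; exact hNd k
  obtain ⟨g, hg, hgdet⟩ := cramer_solve Nρ hNρ0 w fun i => hdvdρ.trans (hmain i)
  have hg0 : g i0 = 0 := by
    have h0 : (Nρ.updateRow i0 w).det = 0 := by
      apply zero_dvd_iff.1
      apply dvd_det hα0
      intro i
      by_cases hi : i = i0
      · subst hi
        rw [Matrix.updateRow_self, hwapp]
        simp [z, hv, lin]
      · rw [Matrix.updateRow_ne hi, hNρ, applyD_rhoD, hN1 i hi, hθ'α, map_zero]
    have := hgdet i0
    rw [h0] at this
    exact (mul_eq_zero.1 this.symm).resolve_left hNρ0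
  let φ : Deriv K ℓ := ∑ i ∈ Finset.univ.erase i0, g i • θ' i
  have hφmem : φ ∈ logDer A :=
    Submodule.sum_mem _ fun i _ => Submodule.smul_mem _ _ (hθ'mem i)
  have hφα : applyD φ α = 0 := by
    simp only [φ]
    rw [applyD_sum]
    apply Finset.sum_eq_zero
    intro i _
    rw [applyD_smul, hθ'α, mul_zero]
  have hidem : ∀ ψ : Deriv K ℓ, rhoD α v (rhoD α v ψ) = rhoD α v ψ := by
    intro ψ; funext i; exact rho_idem hv _
  have hφw : rhoD α v φ = w := by
    have h1 : w = ∑ i ∈ Finset.univ.erase i0, g i • rhoD α v (θ' i) := by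
      rw [hg, ← Finset.add_sum_erase _ _ (Finset.mem_univ i0), hg0, zero_smul, zero_add]
      apply Finset.sum_congr rfl
      intro i hi
      rw [hNρ, hN1 i (Finset.ne_of_mem_erase hi)]
    have h2 : rhoD α v w = w := hidem _
    rw [← h2, h1, rhoD_sum, rhoD_sum]
    apply Finset.sum_congr rfl
    intro i _
    rw [rhoD_smul, rhoD_smul, hidem]
  have hdiv : ∀ k, ∃ e, (Qp T • eulerD K ℓ - φ) k = lin α * e := by
    intro k
    have h0 : rho α v ((Qp T • eulerD K ℓ - φ) k) = 0 := by
      rw [Pi.sub_apply, map_sub, sub_eq_zero]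
      exact (congrFun hφw k).symm
    exact dvd_of_rho_eq_zero h0
  choose η hη using hdiv
  have hη' : lin α • η = Qp T • eulerD K ℓ - φ := by
    funext k; rw [hη]; rfl
  refine ⟨η, ?_, ?_⟩
  · rw [hη']
    exact Submodule.sub_mem _ (Submodule.smul_mem _ _ (euler_mem A)) hφmem
  · have h1 := congrArg (fun ψ => applyD ψ α) hη'
    simp only [applyD_smul, applyD_sub, hφα, applyD_euler, sub_zero] at h1
    exact mul_left_cancel₀ hlα (by rw [h1]; ring)

/-! ### Homogeneity -/

lemma hc_mul {h : S K ℓ} {d : ℕ} (hh : h.IsHomogeneous d) (g : S K ℓ) (n : ℕ) :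
    homogeneousComponent n (g * h) = if d ≤ n then homogeneousComponent (n - d) g * h else 0 := by
  conv_lhs => rw [← sum_homogeneousComponent g, Finset.sum_mul, map_sum]
  have h1 : ∀ i, homogeneousComponent n (homogeneousComponent i g * h)
      = if n = i + d then homogeneousComponent i g * h else 0 := by
    intro i
    have := (homogeneousComponent_isHomogeneous i g).mul hh
    rw [homogeneousComponent_of_mem ((mem_homogeneousSubmodule _ _).2 this)]
  simp only [h1]
  split_ifs with hd
  · by_cases hr : n - d < g.totalDegree + 1
    · rw [Finset.sum_eq_single_of_mem (n - d) (Finset.mem_range.2 hr)]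
      · rw [if_pos (by omega)]
      · intro b _ hb
        rw [if_neg (by omega)]
    · rw [homogeneousComponent_eq_zero _ _ (by omega), zero_mul]
      apply Finset.sum_eq_zero
      intro b hb
      rw [Finset.mem_range] at hb
      rw [if_neg (by omega)]
  · apply Finset.sum_eq_zero
    intro b hb
    rw [if_neg (by omega)]

lemma hc_self {p : S K ℓ} {n : ℕ} (h : p.IsHomogeneous n) : homogeneousComponent n p = p :=
  homogeneousComponent_eq_self h

/-- homogeneous component of a derivation -/
noncomputable def hcD (n : ℕ) (θ : Deriv K ℓ) : Deriv K ℓ := fun i => homogeneousComponent n (θ i)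

lemma applyD_hcD (n : ℕ) (θ : Deriv K ℓ) (α : Fin ℓ → K) :
    applyD (hcD n θ) α = homogeneousComponent n (applyD θ α) := by
  simp [applyD, hcD, homogeneousComponent_C_mul]

lemma hcD_mem {A : Finset (Fin ℓ → K)} {θ : Deriv K ℓ} (h : θ ∈ logDer A) (n : ℕ) :
    hcD n θ ∈ logDer A := by
  intro β hβ
  obtain ⟨g, hg⟩ := h β hβ
  rw [applyD_hcD, hg, mul_comm, hc_mul (lin_homog β)]
  split_ifs
  · exact Dvd.intro_left _ rfl
  · simp

lemma Qp_homog (T : Finset (Fin ℓ → K)) : (Qp T).IsHomogeneous T.card := by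
  have := IsHomogeneous.prod T lin (fun _ => 1) fun β _ => lin_homog β
  simpa [Qp] using this

lemma isUnit_of_homog_zero {g : S K ℓ} (h0 : g ≠ 0) (h : g.IsHomogeneous 0) : IsUnit g := by
  have h1 := hc_self h
  rw [homogeneousComponent_zero] at h1
  rw [← h1]
  have : coeff 0 g ≠ 0 := by
    intro hc; rw [hc] at h1; simp at h1; exact h0 h1.symm
  exact (isUnit_iff_ne_zero.2 this).map C

lemma surj_homog {A : Finset (Fin ℓ → K)} (hA : Red A) {θ : Fin ℓ → Deriv K ℓ} (hθ : Sai A θ)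
    (i0 : Fin ℓ) (hE : θ i0 = eulerD K ℓ) {α : Fin ℓ → K} (hα : α ∈ A)
    (T R : Finset (Fin ℓ → K)) (hcov : ∀ β ∈ A.erase α, β ∈ T ∨ β ∈ R)
    (hR : Set.InjOn (fun β => hyp α ⊓ hyp β) (R : Set (Fin ℓ → K))) :
    ∃ η : Deriv K ℓ, IsHomog η T.card ∧ lin α • η ∈ logDer A ∧ applyD η α = Qp T := by
  obtain ⟨η, h1, h2⟩ := surj hA hθ i0 hE hα T R hcov hR
  refine ⟨hcD T.card η, fun i => homogeneousComponent_isHomogeneous _ _, ?_, ?_⟩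
  · have := hcD_mem h1 (T.card + 1)
    convert this using 1
    funext k
    simp only [hcD, Pi.smul_apply, smul_eq_mul]
    rw [mul_comm (lin α) (η k), hc_mul (lin_homog α), if_pos (by omega), Nat.add_sub_cancel,
      mul_comm]
  · rw [applyD_hcD, h2, hc_self (Qp_homog T)]

lemma homog_coeff {A : Finset (Fin ℓ → K)} (hA : Red A) {θ : Fin ℓ → Deriv K ℓ} (hθ : Sai A θ)
    {δ : Fin ℓ → ℕ} (hδ : ∀ i, IsHomog (θ i) (δ i)) {ψ : Deriv K ℓ} (hψ : ψ ∈ logDer A) {e : ℕ}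
    (he : IsHomog ψ e) : ∃ g : Fin ℓ → S K ℓ, ψ = ∑ i, g i • θ i ∧
      ∀ i, g i ≠ 0 → δ i ≤ e ∧ (g i).IsHomogeneous (e - δ i) := by
  obtain ⟨g, hg⟩ := hθ.exists_coeff hA hψ
  refine ⟨fun i => if δ i ≤ e then homogeneousComponent (e - δ i) (g i) else 0, ?_, ?_⟩
  · funext k
    have h1 := congrFun hg k
    rw [← hc_self (he k), h1]
    simp only [Finset.sum_apply, Pi.smul_apply, smul_eq_mul, map_sum]
    apply Finset.sum_congr rfl
    intro i _
    rw [hc_mul (hδ i k)]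
    split_ifs <;> simp
  · intro i hi
    by_cases h : δ i ≤ e
    · refine ⟨h, ?_⟩
      simp only [h, if_true]
      exact homogeneousComponent_isHomogeneous _ _
    · simp [h] at hi

lemma Sai.exchange {A : Finset (Fin ℓ → K)} {θ : Fin ℓ → Deriv K ℓ} (hθ : Sai A θ)
    {ψ : Deriv K ℓ} (hψ : ψ ∈ logDer A) {g : Fin ℓ → S K ℓ} (hg : ψ = ∑ i, g i • θ i)
    (i k : Fin ℓ) (hu : IsUnit (g i)) :
    Sai A (fun m => Function.update θ i ψ (Equiv.swap i k m)) := by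
  have hdet : ∃ u : S K ℓ, IsUnit u ∧
      (Matrix.of (fun m => Function.update θ i ψ (Equiv.swap i k m))).det
        = (Matrix.of θ).det * u := by
    have h1 : (Matrix.of (fun m => Function.update θ i ψ (Equiv.swap i k m)))
        = ((Matrix.of θ).updateRow i ψ).submatrix (Equiv.swap i k) id := rfl
    have h2 : ((Matrix.of θ).updateRow i ψ).det = g i * (Matrix.of θ).det := by
      have := Matrix.det_updateRow_sum (Matrix.of θ) i g
      rw [smul_eq_mul] at this
      rw [← this, hg]
      rfl
    rw [h1, Matrix.det_permute, h2]
    refine ⟨((Equiv.Perm.sign (Equiv.swap i k) : ℤ) : S K ℓ) * g i, ?_, by ring⟩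
    refine IsUnit.mul ?_ hu
    exact (Units.isUnit (Equiv.Perm.sign (Equiv.swap i k))).map (Int.castRingHom (S K ℓ))
  obtain ⟨u, huu, hdet⟩ := hdet
  refine ⟨?_, ?_, ?_⟩
  · intro m
    by_cases h : Equiv.swap i k m = i
    · simp only [h, Function.update_self]; exact hψ
    · simp only [Function.update_of_ne h]; exact hθ.1 _
  · rw [hdet]; exact mul_ne_zero hθ.2.1 huu.ne_zero
  · rw [hdet]; exact (huu.mul_right_dvd).2 hθ.2.2

lemma logDer_eq {A A0 : Finset (Fin ℓ → K)} (hsub : A0 ⊆ A) (h0 : ∀ β ∈ A0, β ≠ 0)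
    (h : ∀ β ∈ A, ∃ γ ∈ A0, hyp γ = hyp β) : logDer A = logDer A0 := by
  apply le_antisymm
  · intro θ hθ β hβ
    exact hθ β (hsub hβ)
  · intro θ hθ β hβ
    obtain ⟨γ, hγ, hγβ⟩ := h β hβ
    obtain ⟨c, rfl⟩ := dvd_of_hyp_le (h0 γ hγ) hγβ.le
    rw [lin_smul, applyD_smul_right]
    exact mul_dvd_mul_left _ (hθ γ hγ)

lemma exists_reduced (A : Finset (Fin ℓ → K)) (hA : ∀ α ∈ A, α ≠ 0) :
    ∃ A0 ⊆ A, Red A0 ∧ ∀ β ∈ A, ∃ γ ∈ A0, hyp γ = hyp β := by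
  obtain ⟨u, hu, hinj, him⟩ := Finset.exists_subset_injOn_image_eq_of_surjOn (f := hyp)
    (A : Set (Fin ℓ → K)) (A.image hyp) (by
      intro y hy
      simpa using hy)
  refine ⟨u, by exact_mod_cast hu, ⟨fun α hα => hA α (hu hα), hinj⟩, ?_⟩
  intro β hβ
  have : hyp β ∈ u.image hyp := by rw [him]; exact Finset.mem_image_of_mem _ hβ
  simpa using this

lemma exists_transversal {X Y : Type*} (f : X → Y) (E P : Finset X) (hP : P ⊆ E)
    (hinj : Set.InjOn f (P : Set X)) :
    ∃ R : Finset X, P ⊆ R ∧ R ⊆ E ∧ Set.InjOn f (R : Set X) ∧ E.image f ⊆ R.image f := by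
  obtain ⟨u, h1, h2, h3, h4⟩ := hinj.exists_subset_injOn_subset_range_eq (s := (E : Set X))
    (by exact_mod_cast hP)
  have hfin : u.Finite := E.finite_toSet.subset h2
  refine ⟨hfin.toFinset, ?_, ?_, ?_, ?_⟩
  · intro p hp; simpa using h1 hp
  · intro p hp; simp at hp; exact h2 hp
  · simpa using h4
  · intro y hy
    have : y ∈ f '' (E : Set X) := by simpa using hy
    rw [← h3] at this
    simpa using this

lemma exists_dual {ι : Type*} [Fintype ι] (α : ι → (Fin ℓ → K)) (Xs : Submodule K (Fin ℓ → K))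
    (hXs : ∀ x, x ∈ Xs ↔ ∀ j, α j ⬝ᵥ x = 0) (h : Module.finrank K Xs + Fintype.card ι = ℓ) (j : ι) :
    ∃ v, ∀ k, α k ⬝ᵥ v = if k = j then 1 else 0 := by
  let L := (Matrix.of α).mulVecLin
  have hker : LinearMap.ker L = Xs := by
    ext x
    rw [hXs, LinearMap.mem_ker]
    simp only [L, Matrix.mulVecLin_apply, funext_iff]
    rfl
  have h1 := LinearMap.finrank_range_add_finrank_ker L
  rw [hker, Module.finrank_fin_fun] at h1
  have h2 : LinearMap.range L = ⊤ := by
    apply Submodule.eq_top_of_finrank_eq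
    rw [Module.finrank_fintype_fun_eq_card]
    omega
  have : (fun k => if k = j then (1 : K) else 0) ∈ LinearMap.range L := by rw [h2]; trivial
  obtain ⟨v, hv⟩ := this
  exact ⟨v, fun k => congrFun hv k⟩
end ArrPaper


open ArrPaper in
/-- Multiple Deletion Theorem, MDT. -/
theorem stmt4 {K : Type*} [Field K] {ℓ : ℕ} (A : Finset (Fin ℓ → K))
    (hA0 : ∀ α ∈ A, α ≠ 0)
    (d : ℕ → ℕ) (hd1 : d 1 = 1)
    (hmono : ∀ i j, 1 ≤ i → i ≤ j → j ≤ ℓ → d i ≤ d j) (hd2 : 1 < d 2)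
    (hfree : IsFreeWithExp A (fun i => d ((i : ℕ) + 1)))
    (q : ℕ) (hq2 : 2 ≤ q) (hqℓ : q ≤ ℓ)
    (α : ℕ → (Fin ℓ → K)) (hαA : ∀ j ∈ Finset.Icc 2 q, α j ∈ A)
    (A' : Finset (Fin ℓ → K)) (hA' : A' = A \ (Finset.Icc 2 q).image α)
    (h1 : ∀ j ∈ Finset.Icc 2 q, A.card = (restH (A.erase (α j)) (α j)).card + d j)
    (Xs : Submodule K (Fin ℓ → K)) (hXs : Xs = (Finset.Icc 2 q).inf (fun j => hyp (α j)))
    (h2 : codim Xs = q - 1)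
    (h3 : ¬ (Xs : Set (Fin ℓ → K)) ⊆ ⋃ β ∈ A', (hyp β : Set (Fin ℓ → K))) :
    IsFreeWithExp A' (fun i => if 2 ≤ (i : ℕ) + 1 ∧ (i : ℕ) + 1 ≤ q
        then d ((i : ℕ) + 1) - 1 else d ((i : ℕ) + 1)) ∧
    ∃ η θ : ℕ → Deriv K ℓ,
      (∀ j ∈ Finset.Icc 2 q, IsHomog (η j) (d j - 1)) ∧
      (∀ j ∈ Finset.Icc (q+1) ℓ, IsHomog (θ j) (d j)) ∧
      IsBasisOf (fun i : Fin ℓ =>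
        if (i : ℕ) = 0 then eulerD K ℓ
        else if (i : ℕ) + 1 ≤ q then lin (α ((i : ℕ) + 1)) • η ((i : ℕ) + 1)
        else θ ((i : ℕ) + 1)) (logDer A) := by
  classical
  -- the generic point
  have hxX : ∀ y, y ∈ Xs ↔ ∀ j ∈ Finset.Icc 2 q, α j ⬝ᵥ y = 0 := by
    intro y
    rw [hXs, Submodule.mem_finsetInf]
    exact forall₂_congr fun j _ => mem_hyp
  have hfin : Module.finrank K Xs ≤ ℓ := by
    simpa using Submodule.finrank_le Xs
  have hcod : Module.finrank K Xs + (q - 1) = ℓ := by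
    unfold codim at h2; omega
  obtain ⟨x, hx0, hxXs, hxA'⟩ : ∃ x : Fin ℓ → K, x ≠ 0 ∧ x ∈ Xs ∧ ∀ β ∈ A', β ⬝ᵥ x ≠ 0 := by
    rcases A'.eq_empty_or_nonempty with he | ⟨β, hβ⟩
    · have hne : Xs ≠ ⊥ := by
        intro hb
        rw [hb] at hcod
        simp at hcod
        omega
      obtain ⟨y, hy, hy0⟩ := Submodule.exists_mem_ne_zero_of_ne_bot hne
      exact ⟨y, hy0, hy, by simp [he]⟩
    · obtain ⟨y, hy, hy'⟩ := Set.not_subset.1 h3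
      have hy2 : ∀ β ∈ A', β ⬝ᵥ y ≠ 0 := by
        intro γ hγ h0
        exact hy' (Set.mem_iUnion₂.2 ⟨γ, hγ, mem_hyp.2 h0⟩)
      refine ⟨y, ?_, hy, hy2⟩
      rintro rfl
      exact hy2 β hβ (by simp)
  have hxα := (hxX x).1 hxXs
  have hdual : ∀ j ∈ Finset.Icc 2 q, ∃ v, ∀ k ∈ Finset.Icc 2 q,
      α k ⬝ᵥ v = if k = j then 1 else 0 := by
    intro j hj
    obtain ⟨v, hv⟩ := exists_dual (fun k : ↥(Finset.Icc 2 q) => α k) Xs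
      (by intro y; rw [hxX]; simp) (by simp; omega) ⟨j, hj⟩
    refine ⟨v, fun k hk => ?_⟩
    have := hv ⟨k, hk⟩
    simpa using this
  have hαne : ∀ j ∈ Finset.Icc 2 q, ∀ k ∈ Finset.Icc 2 q, j ≠ k → hyp (α k) ≠ hyp (α j) := by
    intro j hj k hk hjk h
    obtain ⟨v, hv⟩ := hdual j hj
    have h1 : v ∈ hyp (α k) := by rw [mem_hyp, hv k hk, if_neg (Ne.symm hjk)]
    rw [h, mem_hyp, hv j hj, if_pos rfl] at h1
    exact one_ne_zero h1
  have huniq : ∀ j ∈ Finset.Icc 2 q, ∀ β ∈ A, hyp β = hyp (α j) → β = α j := by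
    intro j hj β hβ h
    by_cases hβA' : β ∈ A'
    · exact absurd (mem_hyp.1 (h ▸ mem_hyp.2 (hxα j hj))) (hxA' β hβA')
    · rw [hA', Finset.mem_sdiff] at hβA'
      push Not at hβA'
      obtain ⟨k, hk, rfl⟩ := Finset.mem_image.1 (hβA' hβ)
      by_cases hjk : j = k
      · rw [hjk]
      · exact absurd h (hαne j hj k hk hjk)
  have hαinj : Set.InjOn α (Finset.Icc 2 q : Finset ℕ) := by
    intro j hj k hk h
    by_contra hjk
    exact hαne j hj k hk hjk (by rw [h])
  -- reduced version
  obtain ⟨A0, hA0A, hred, hrep⟩ := exists_reduced A hA0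
  have hαA0 : ∀ j ∈ Finset.Icc 2 q, α j ∈ A0 := by
    intro j hj
    obtain ⟨γ, hγ, h⟩ := hrep _ (hαA j hj)
    rwa [← huniq j hj γ (hA0A hγ) h]
  have hlogA : logDer A = logDer A0 := logDer_eq hA0A hred.1 hrep
  have hA0A' : ∀ β ∈ A0, β ∉ (Finset.Icc 2 q).image α → β ∈ A' := by
    intro β hβ h
    rw [hA', Finset.mem_sdiff]
    exact ⟨hA0A hβ, h⟩
  have h2mem : 2 ∈ Finset.Icc 2 q := Finset.mem_Icc.2 ⟨le_rfl, hq2⟩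
  have hℓ : 0 < ℓ := by omega
  let i0 : Fin ℓ := ⟨0, hℓ⟩
  -- main induction
  have main : ∀ j, 1 ≤ j → j ≤ q → ∃ (Θ : Fin ℓ → Deriv K ℓ) (η : ℕ → Deriv K ℓ),
      Sai A0 Θ ∧ (∀ i, IsHomog (Θ i) (d ((i : ℕ) + 1))) ∧ Θ i0 = eulerD K ℓ ∧
      ∀ i : Fin ℓ, 1 ≤ (i : ℕ) → (i : ℕ) + 1 ≤ j →
        Θ i = lin (α ((i : ℕ) + 1)) • η ((i : ℕ) + 1) ∧
        IsHomog (η ((i : ℕ) + 1)) (d ((i : ℕ) + 1) - 1) := by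
    intro j hj1
    induction j, hj1 using Nat.le_induction with
    | base =>
      intro _
      obtain ⟨θ, hbas, hhom⟩ := hfree
      rw [hlogA] at hbas
      have hS := sai_of_isBasisOf hred ⟨_, hαA0 2 h2mem⟩ hbas
      have hEh : IsHomog (eulerD K ℓ) 1 := fun i => isHomogeneous_X K i
      obtain ⟨g, hg, hg'⟩ := homog_coeff hred hS hhom (euler_mem A0) hEh
      have hgi : ∀ i, i ≠ i0 → g i = 0 := by
        intro i hi
        by_contra h0
        have h1 := (hg' i h0).1
        have hi' : (i : ℕ) ≠ 0 := fun h => hi (Fin.ext h)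
        have h2 := hmono 2 ((i : ℕ) + 1) (by omega) (by omega) (by omega)
        omega
      have hg0 : g i0 ≠ 0 := by
        intro h0
        have : eulerD K ℓ = 0 := by
          rw [hg]
          apply Finset.sum_eq_zero
          intro i _
          by_cases hi : i = i0
          · rw [hi, h0, zero_smul]
          · rw [hgi i hi, zero_smul]
        exact X_ne_zero (R := K) i0 (congrFun this i0)
      have hunit : IsUnit (g i0) := by
        apply isUnit_of_homog_zero hg0
        have := (hg' i0 hg0).2
        simpa [i0, hd1] using this
      have hex := hS.exchange (euler_mem A0) hg i0 i0 hunit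
      have hv0 : Function.update θ i0 (eulerD K ℓ) (Equiv.swap i0 i0 i0) = eulerD K ℓ := by
        rw [Equiv.swap_apply_left, Function.update_self]
      have hv1 : ∀ m, m ≠ i0 →
          Function.update θ i0 (eulerD K ℓ) (Equiv.swap i0 i0 m) = θ m := by
        intro m hm
        rw [Equiv.swap_apply_of_ne_of_ne hm hm, Function.update_of_ne hm]
      refine ⟨_, fun _ => 0, hex, ?_, ?_, ?_⟩
      · intro i
        show IsHomog (Function.update θ i0 (eulerD K ℓ) (Equiv.swap i0 i0 i)) _
        by_cases hi : i = i0
        · subst hi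
          rw [hv0]
          simpa [i0, hd1] using hEh
        · rw [hv1 i hi]
          exact hhom i
      · exact hv0
      · intro i h1 h2
        omega
    | succ j hj1 ih =>
      intro hjq
      obtain ⟨Θ, η, hS, hhom, hE, hη⟩ := ih (by omega)
      set J := j + 1 with hJ
      have hJm : J ∈ Finset.Icc 2 q := Finset.mem_Icc.2 ⟨by omega, hjq⟩
      have hαJ := hαA0 J hJm
      have hαJ0 := hred.1 _ hαJ
      -- choose the transversal
      let f : (Fin ℓ → K) → Submodule K (Fin ℓ → K) := fun β => hyp (α J) ⊓ hyp β
      obtain ⟨R, hPR, hRE, hRinj, hRim⟩ := exists_transversal f (A0.erase (α J))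
        (((Finset.Icc 2 q).image α).erase (α J))
        (by
          apply Finset.erase_subset_erase
          intro β hβ
          obtain ⟨k, hk, rfl⟩ := Finset.mem_image.1 hβ
          exact hαA0 k hk)
        (by
          intro β hβ γ hγ h
          simp only [Finset.coe_erase, Set.mem_sdiff, Finset.mem_coe, Finset.mem_image,
            Set.mem_singleton_iff] at hβ hγ
          obtain ⟨⟨k, hk, rfl⟩, hkJ⟩ := hβ
          obtain ⟨⟨n, hn, rfl⟩, hnJ⟩ := hγ
          by_contra hne
          have hkn : k ≠ n := fun h => hne (by rw [h])
          obtain ⟨v, hv⟩ := hdual k hk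
          have hv1 : v ∈ f (α n) := by
            refine Submodule.mem_inf.2 ⟨?_, ?_⟩
            · rw [mem_hyp, hv J hJm, if_neg]
              rintro rfl; exact hkJ rfl
            · rw [mem_hyp, hv n hn, if_neg (Ne.symm hkn)]
          have hv2 : v ∈ f (α k) := by rw [h]; exact hv1
          have hv3 := mem_hyp.1 (Submodule.mem_inf.1 hv2).2
          rw [hv k hk, if_pos rfl] at hv3
          exact one_ne_zero hv3)
      let T := (A0.erase (α J)) \ R
      obtain ⟨ηJ, hηh, hηmem, hηα⟩ := surj_homog hred hS i0 hE hαJ T R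
        (by
          intro β hβ
          by_cases h : β ∈ R
          · exact Or.inr h
          · exact Or.inl (Finset.mem_sdiff.2 ⟨hβ, h⟩)) hRinj
      have hTx : eval x (Qp T) ≠ 0 := by
        rw [Qp, map_prod]
        apply Finset.prod_ne_zero_iff.2
        intro β hβ
        rw [eval_lin]
        obtain ⟨hβE, hβR⟩ := Finset.mem_sdiff.1 hβ
        apply hxA'
        apply hA0A' β (Finset.mem_of_mem_erase hβE)
        intro hβα
        exact hβR (hPR (Finset.mem_erase.2 ⟨Finset.ne_of_mem_erase hβE, hβα⟩))
      have hTcard : T.card + 1 ≤ d J := by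
        have hc1 : (restH (A.erase (α J)) (α J)).card ≤ R.card := by
          have hsub : restH (A.erase (α J)) (α J) ⊆ R.image f := by
            intro y hy
            obtain ⟨β, hβ, rfl⟩ := Finset.mem_image.1 hy
            apply hRim
            obtain ⟨γ, hγ, hγβ⟩ := hrep β (Finset.mem_of_mem_erase hβ)
            refine Finset.mem_image.2 ⟨γ, Finset.mem_erase.2 ⟨?_, hγ⟩, ?_⟩
            · rintro rfl
              exact Finset.ne_of_mem_erase hβ
                (huniq J hJm β (Finset.mem_of_mem_erase hβ) hγβ.symm)
            · simp only [f, hγβ]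
          exact (Finset.card_le_card hsub).trans Finset.card_image_le
        have hc2 : T.card = (A0.erase (α J)).card - R.card := Finset.card_sdiff_of_subset hRE
        have hc3 : (A0.erase (α J)).card = A0.card - 1 := Finset.card_erase_of_mem hαJ
        have hc4 : R.card ≤ (A0.erase (α J)).card := Finset.card_le_card hRE
        have hc5 : A0.card ≤ A.card := Finset.card_le_card hA0A
        have hc6 : 0 < A0.card := Finset.card_pos.2 ⟨_, hαJ⟩
        have := h1 J hJm
        omega
      have hψh : IsHomog (lin (α J) • ηJ) (T.card + 1) := by
        intro k
        have := (lin_homog (α J)).mul (hηh k)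
        rw [add_comm]
        exact this
      obtain ⟨g, hg, hg'⟩ := homog_coeff hred hS hhom hηmem hψh
      obtain ⟨i, hij, hgi⟩ : ∃ i : Fin ℓ, j ≤ (i : ℕ) ∧ g i ≠ 0 := by
        by_contra hcon
        push Not at hcon
        have claim : ∀ i : Fin ℓ, i ≠ i0 → (∀ k, eval x (g i * Θ i k) = 0) ∧
            ∃ h, applyD (g i • Θ i) (α J) = lin (α J) * h ∧ eval x h = 0 := by
          intro i hi
          have hi' : (i : ℕ) ≠ 0 := fun h => hi (Fin.ext h)
          by_cases hij : j ≤ (i : ℕ)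
          · rw [hcon i hij]
            refine ⟨fun k => by simp, 0, by simp [applyD], by simp⟩
          · have him : (i : ℕ) + 1 ∈ Finset.Icc 2 q := Finset.mem_Icc.2 ⟨by omega, by omega⟩
            obtain ⟨hΘ, -⟩ := hη i (by omega) (by omega)
            have hev : eval x (lin (α ((i : ℕ) + 1))) = 0 := by
              rw [eval_lin, hxα _ him]
            have hdv : lin (α J) ∣ applyD (η ((i : ℕ) + 1)) (α J) := by
              have h3 := hS.1 i (α J) hαJ
              rw [hΘ, applyD_smul] at h3
              refine ((lin_prime hαJ0).dvd_or_dvd h3).resolve_left ?_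
              intro h4
              exact hαne J hJm _ him (by omega)
                (hyp_eq_of_le hαJ0 (hred.1 _ (hαA0 _ him)) (hyp_le_of_dvd h4)).symm
            obtain ⟨h, hh⟩ := hdv
            refine ⟨fun k => ?_, g i * lin (α ((i : ℕ) + 1)) * h, ?_, ?_⟩
            · rw [hΘ]
              simp [hev]
            · rw [applyD_smul, hΘ, applyD_smul, hh]; ring
            · simp [hev]
        have hg0 : eval x (g i0) = 0 := by
          obtain ⟨k, hk⟩ := Function.ne_iff.1 hx0
          have h4 := congrArg (eval x) (congrFun hg k)
          simp only [Finset.sum_apply, Pi.smul_apply, smul_eq_mul] at h4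
          rw [map_sum, Finset.sum_eq_single_of_mem i0 (Finset.mem_univ _)
            (fun i _ hi => (claim i hi).1 k)] at h4
          simp only [map_mul, eval_lin, hxα J hJm, hE, eulerD,
            eval_X, zero_mul] at h4
          exact (mul_eq_zero.1 h4.symm).resolve_right hk
        have claim2 : ∀ i : Fin ℓ, ∃ h, applyD (g i • Θ i) (α J) = lin (α J) * h ∧
            eval x h = 0 := by
          intro i
          by_cases hi : i = i0
          · subst hi
            exact ⟨g i0, by rw [applyD_smul, hE, applyD_euler, mul_comm], hg0⟩
          · exact (claim i hi).2
        choose h hh1 hh2 using claim2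
        have h5 := congrArg (fun ψ => applyD ψ (α J)) hg
        simp only [applyD_smul, applyD_sum, hηα] at h5
        have h6 : Qp T = ∑ i, h i := by
          apply mul_left_cancel₀ (lin_ne_zero hαJ0)
          rw [h5, Finset.mul_sum]
          apply Finset.sum_congr rfl
          intro i _
          rw [← hh1, applyD_smul]
        apply hTx
        rw [h6, map_sum]
        exact Finset.sum_eq_zero fun i _ => hh2 i
      obtain ⟨hle, hgh⟩ := hg' i hgi
      have hmn := hmono J ((i : ℕ) + 1) (by omega) (by omega) (by omega)
      have hdeq : d ((i : ℕ) + 1) = d J := by omega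
      have hTeq : T.card + 1 = d J := by omega
      have hunit : IsUnit (g i) := by
        apply isUnit_of_homog_zero hgi
        rwa [show T.card + 1 - d ((i : ℕ) + 1) = 0 by omega] at hgh
      let k : Fin ℓ := ⟨j, by omega⟩
      have hex := hS.exchange hηmem hg i k hunit
      have hval : ∀ m : Fin ℓ, m ≠ k → m ≠ i →
          Function.update Θ i (lin (α J) • ηJ) (Equiv.swap i k m) = Θ m := by
        intro m hm1 hm2
        rw [Equiv.swap_apply_of_ne_of_ne hm2 hm1, Function.update_of_ne hm2]
      have hvalk : Function.update Θ i (lin (α J) • ηJ) (Equiv.swap i k k) = lin (α J) • ηJ := by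
        rw [Equiv.swap_apply_right, Function.update_self]
      refine ⟨_, Function.update η J ηJ, hex, ?_, ?_, ?_⟩
      · intro m
        by_cases hmk : m = k
        · subst hmk
          rw [hvalk]
          show IsHomog _ (d J)
          rw [← hTeq]; exact hψh
        · by_cases hmi : m = i
          · subst hmi
            simp only [Equiv.swap_apply_left]
            rw [Function.update_of_ne (Ne.symm hmk), hdeq]
            exact hhom k
          · rw [hval m hmk hmi]; exact hhom m
      · show Function.update Θ i (lin (α J) • ηJ) (Equiv.swap i k i0) = _
        rw [hval i0, hE]
        · intro h
          have := congrArg Fin.val h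
          simp [i0, k] at this
          omega
        · intro h
          have := congrArg Fin.val h
          simp [i0] at this
          omega
      · intro m hm1 hm2
        show Function.update Θ i (lin (α J) • ηJ) (Equiv.swap i k m) = _ ∧ _
        by_cases hmk : m = k
        · subst hmk
          rw [hvalk]
          show _ = lin (α J) • Function.update η J ηJ J ∧
            IsHomog (Function.update η J ηJ J) (d J - 1)
          rw [Function.update_self]
          refine ⟨rfl, ?_⟩
          rw [← hTeq]; exact hηh
        · have hmj : (m : ℕ) ≠ j := fun h => hmk (Fin.ext h)
          rw [hval m hmk (by rintro rfl; omega), Function.update_of_ne (by omega)]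
          exact hη m hm1 (by omega)
  obtain ⟨Θ, η, hS, hhom, hE, hη⟩ := main q (by omega) le_rfl
  refine ⟨?_, η, fun n => if h : n - 1 < ℓ then Θ ⟨n - 1, h⟩ else 0, ?_, ?_, ?_⟩
  · -- deletion
    let A1 := A0 \ (Finset.Icc 2 q).image α
    have hred1 : Red A1 := ⟨fun β hβ => hred.1 β (Finset.mem_sdiff.1 hβ).1,
      hred.2.mono fun β hβ => (Finset.mem_sdiff.1 hβ).1⟩
    have hlog1 : logDer A' = logDer A1 := by
      apply logDer_eq _ hred1.1
      · intro β hβ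
        obtain ⟨γ, hγ, hγβ⟩ := hrep β (by rw [hA'] at hβ; exact (Finset.mem_sdiff.1 hβ).1)
        refine ⟨γ, Finset.mem_sdiff.2 ⟨hγ, ?_⟩, hγβ⟩
        intro hγα
        obtain ⟨k, hk, rfl⟩ := Finset.mem_image.1 hγα
        exact hxA' β hβ (mem_hyp.1 (hγβ ▸ mem_hyp.2 (hxα k hk)))
      · intro β hβ
        obtain ⟨h1, h2⟩ := Finset.mem_sdiff.1 hβ
        exact hA0A' β h1 h2
    let Θ' : Fin ℓ → Deriv K ℓ := fun i =>
      if 2 ≤ (i : ℕ) + 1 ∧ (i : ℕ) + 1 ≤ q then η ((i : ℕ) + 1) else Θ i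
    let F : ℕ → S K ℓ := fun n => if 2 ≤ n ∧ n ≤ q then lin (α n) else 1
    have hΘΘ' : ∀ i, Θ i = F ((i : ℕ) + 1) • Θ' i := by
      intro i
      by_cases h : 2 ≤ (i : ℕ) + 1 ∧ (i : ℕ) + 1 ≤ q
      · simp only [F, Θ', if_pos h]
        exact (hη i (by omega) h.2).1
      · simp only [F, Θ', if_neg h, one_smul]
    have hF : ∏ i : Fin ℓ, F ((i : ℕ) + 1) = Qp ((Finset.Icc 2 q).image α) := by
      have hr : ∀ N, ∏ n ∈ Finset.range N, F (n + 1) = ∏ n ∈ Finset.Icc 1 N, F n := by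
        intro N
        induction N with
        | zero => simp
        | succ N ih => rw [Finset.prod_range_succ, ih, Finset.prod_Icc_succ_top (by omega)]
      rw [← Finset.prod_range (fun n => F (n + 1)), Qp, Finset.prod_image hαinj, hr]
      have hsub : Finset.Icc 2 q ⊆ Finset.Icc 1 ℓ := Finset.Icc_subset_Icc (by omega) hqℓ
      rw [← Finset.prod_subset hsub]
      · apply Finset.prod_congr rfl
        intro n hn
        simp only [F, if_pos (Finset.mem_Icc.1 hn)]
      · intro n _ hn2
        rw [Finset.mem_Icc] at hn2
        simp only [F, if_neg hn2]
    have hdet : (Matrix.of Θ).det = Qp ((Finset.Icc 2 q).image α) * (Matrix.of Θ').det := by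
      rw [← hF, ← Matrix.det_mul_column]
      congr 1
      ext1 i k
      exact congrFun (hΘΘ' i) k
    have hQ : Qp A0 = Qp ((Finset.Icc 2 q).image α) * Qp A1 := by
      have hsub : (Finset.Icc 2 q).image α ⊆ A0 := by
        intro β hβ
        obtain ⟨k, hk, rfl⟩ := Finset.mem_image.1 hβ
        exact hαA0 k hk
      rw [mul_comm]
      exact (Finset.prod_sdiff hsub).symm
    have hS1 : Sai A1 Θ' := by
      refine ⟨?_, ?_, ?_⟩
      · intro i β hβ
        obtain ⟨hβ0, hβα⟩ := Finset.mem_sdiff.1 hβ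
        have h3 := hS.1 i β hβ0
        rw [hΘΘ' i, applyD_smul] at h3
        refine ((lin_prime (hred.1 β hβ0)).dvd_or_dvd h3).resolve_left ?_
        by_cases h : 2 ≤ (i : ℕ) + 1 ∧ (i : ℕ) + 1 ≤ q
        · simp only [F, if_pos h]
          intro h4
          have him := Finset.mem_Icc.2 h
          have h5 := hred.2 hβ0 (hαA0 _ him)
            (hyp_eq_of_le (hred.1 β hβ0) (hred.1 _ (hαA0 _ him)) (hyp_le_of_dvd h4))
          exact hβα (Finset.mem_image.2 ⟨_, him, h5.symm⟩)
        · simp only [F, if_neg h]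
          exact fun h4 => (lin_prime (hred.1 β hβ0)).not_isUnit (isUnit_of_dvd_one h4)
      · intro h0
        exact hS.2.1 (by rw [hdet, h0, mul_zero])
      · have h3 := hS.2.2
        rw [hdet, hQ] at h3
        refine (mul_dvd_mul_iff_left ?_).1 h3
        intro h0
        exact hS.2.1 (by rw [hdet, h0, zero_mul])
    refine ⟨Θ', ?_, ?_⟩
    · rw [hlog1]; exact hS1.isBasisOf hred1
    · intro i
      by_cases h : 2 ≤ (i : ℕ) + 1 ∧ (i : ℕ) + 1 ≤ q
      · simp only [Θ', if_pos h]
        exact (hη i (by omega) h.2).2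
      · simp only [Θ', if_neg h]
        exact hhom i
  · intro n hn
    rw [Finset.mem_Icc] at hn
    have := (hη ⟨n - 1, by omega⟩ (by simp; omega) (by simp; omega)).2
    simp only [show n - 1 + 1 = n by omega] at this
    exact this
  · intro n hn
    rw [Finset.mem_Icc] at hn
    have h : n - 1 < ℓ := by omega
    have := hhom ⟨n - 1, h⟩
    simp only [show n - 1 + 1 = n by omega] at this
    simp only [h, dif_pos]
    exact this
  · rw [hlogA]
    convert hS.isBasisOf hred using 1
    funext i
    by_cases hi : (i : ℕ) = 0
    · rw [if_pos hi, show i = i0 from Fin.ext hi, hE]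
    · rw [if_neg hi]
      by_cases hiq : (i : ℕ) + 1 ≤ q
      · rw [if_pos hiq, (hη i (by omega) hiq).1]
      · rw [if_neg hiq]
        simp
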